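/- Let q be a prime power, d ≥ 2, and e ≥ 1 with q^e > 4d² + 1, and let r be a divisor of gcd(d, q^e − 1). Then there exists γ ∈ 𝔽_{q^e} with γ ≠ 0, γ ≠ −1, such that γ generates 𝔽_{q^e} over 𝔽_q and the class of γ/(1+γ) in the quotient group 𝔽_{q^e}^×/(𝔽_{q^e}^×)^d has multiplicative order exactly r. -/

import Mathlib

theorem aux_order {G : Type} [CommGroup G] [Finite G] [IsCyclic G] (d r : ℕ)
    (hr : r ∣ Nat.gcd d (Nat.card G)) :
    ∃ w : G, orderOf (QuotientGroup.mk w : G ⧸ (powMonoidHom d : G →* G).range) = r := by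
  have hc : Nat.card (G ⧸ (powMonoidHom d : G →* G).range) = Nat.gcd (Nat.card G) d := by
    have := IsCyclic.index_powMonoidHom_range (G := G) d
    simpa [Subgroup.index] using this
  have : IsCyclic (G ⧸ (powMonoidHom d : G →* G).range) :=
    isCyclic_of_surjective _ (QuotientGroup.mk'_surjective _)
  obtain ⟨g, hg⟩ := IsCyclic.exists_ofOrder_eq_natCard (α := G ⧸ (powMonoidHom d : G →* G).range)
  rw [hc, Nat.gcd_comm] at hg
  obtain ⟨c, hc'⟩ := hr
  have hpos : 0 < Nat.gcd d (Nat.card G) := Nat.gcd_pos_of_pos_right _ Nat.card_pos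
  obtain ⟨w, hw⟩ := QuotientGroup.mk_surjective (g ^ c)
  refine ⟨w, ?_⟩
  have hc0 : 0 < c := Nat.pos_of_ne_zero (by rintro rfl; omega)
  rw [hw, orderOf_pow_of_dvd hc0.ne' (by rw [hg, hc']; exact dvd_mul_left _ _), hg, hc']
  exact Nat.mul_div_cancel _ hc0

theorem aux_sum (q m : ℕ) (hq : 2 ≤ q) : (∑ k ∈ Finset.Icc 1 m, q ^ k) + 2 ≤ 2 * q ^ m := by
  induction m with
  | zero => simp
  | succ n ih =>
    rw [Finset.sum_Icc_succ_top (by omega), pow_succ]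
    nlinarith [Nat.pow_pos (n := n) (show 0 < q by omega), Nat.mul_le_mul_left (q ^ n) hq]

theorem aux_roots {F : Type} [Field F] [Fintype F] [DecidableEq F] (n : ℕ) (hn : 2 ≤ n) :
    (Finset.univ.filter (fun w : Fˣ => (w : F) ^ n = w)).card ≤ n := by
  have h1 : (Polynomial.X ^ n - Polynomial.X : Polynomial F).natDegree = n :=
    FiniteField.X_pow_card_sub_X_natDegree_eq F hn
  have h0 : (Polynomial.X ^ n - Polynomial.X : Polynomial F) ≠ 0 :=
    FiniteField.X_pow_card_sub_X_ne_zero F hn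
  calc _ ≤ (Polynomial.X ^ n - Polynomial.X : Polynomial F).roots.toFinset.card := by
        refine Finset.card_le_card_of_injOn (fun w : Fˣ => (w : F)) ?_ ?_
        · intro w hw
          simp at hw
          simp [h0, hw]
        · intro a _ b _ h
          exact Units.ext h
    _ ≤ _ := Multiset.toFinset_card_le _
    _ ≤ _ := Polynomial.card_roots' _
    _ = n := h1

theorem aux_gen {Fq Fe : Type} [Field Fq] [Fintype Fq] [Field Fe] [Fintype Fe]
    [Algebra Fq Fe] (q e : ℕ) (hq : Fintype.card Fq = q) 
    (hFe : Fintype.card Fe = q ^ e) (γ w : Fe) (h1 : 1 + γ ≠ 0) (hw : w * (1 + γ) = γ)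
    (hγ : Algebra.adjoin Fq {γ} ≠ ⊤) : ∃ k ∈ Finset.Icc 1 (e / 2), w ^ q ^ k = w := by
  have hint : IsIntegral Fq γ := IsIntegral.of_finite Fq γ
  have hq1 : 1 < q := hq ▸ Fintype.one_lt_card
  set K := IntermediateField.adjoin Fq {γ} with hK
  have hKt : K ≠ ⊤ := by
    intro h
    apply hγ
    rw [← IntermediateField.adjoin_simple_toSubalgebra_of_isAlgebraic hint.isAlgebraic, ← hK, h]
    rfl
  have hγK : γ ∈ K := IntermediateField.mem_adjoin_simple_self Fq γ
  have hwK : w ∈ K := by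
    rw [eq_div_of_mul_eq h1 hw]
    exact div_mem hγK (add_mem (one_mem _) hγK)
  have hfe : Module.finrank Fq Fe = e := by
    have := Module.card_eq_pow_finrank (K := Fq) (V := Fe)
    rw [hFe, hq] at this
    exact (Nat.pow_right_injective hq1 this).symm
  have hmul := Module.finrank_mul_finrank Fq K Fe
  have hne : Module.finrank K Fe ≠ 1 := fun h =>
    hKt (IntermediateField.finrank_eq_one_iff_eq_top.mp h)
  have hp1 : 0 < Module.finrank K Fe := Module.finrank_pos
  have hp2 : 0 < Module.finrank Fq K := Module.finrank_pos
  refine ⟨Module.finrank Fq K, ?_, ?_⟩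
  · rw [Finset.mem_Icc, Nat.le_div_iff_mul_le two_pos]
    refine ⟨hp2, ?_⟩
    rw [← hfe, ← hmul]
    exact Nat.mul_le_mul_left _ (by omega)
  · classical
    have : Fintype K := Fintype.ofFinite _
    have h := FiniteField.pow_card (⟨w, hwK⟩ : K)
    rw [Module.card_eq_pow_finrank (K := Fq) (V := K), hq] at h
    exact congrArg Subtype.val h

/-- for `q^e > 4d² + 1` and `r ∣ gcd(d, q^e − 1)`, there exists a generator
`γ` of `𝔽_{q^e}` over `𝔽_q` with `γ ≠ 0`, `γ ≠ −1`, such that the class of `γ/(1+γ)` in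
`𝔽_{q^e}^×/(𝔽_{q^e}^×)^d` has multiplicative order exactly `r`. -/
theorem stmt7 (q d e r : ℕ) (Fq Fe : Type) [Field Fq] [Fintype Fq] [Field Fe] [Fintype Fe]
    [Algebra Fq Fe]
    (hq : Fintype.card Fq = q) (hd : 2 ≤ d) (he : 1 ≤ e)
    (hFe : Fintype.card Fe = q ^ e)
    (hbig : 4 * d ^ 2 + 1 < q ^ e)
    (hr : r ∣ Nat.gcd d (q ^ e - 1)) :
    ∃ γ : Fe, γ ≠ 0 ∧ γ ≠ -1 ∧ Algebra.adjoin Fq {γ} = ⊤ ∧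
      ∃ w : Feˣ, (w : Fe) * (1 + γ) = γ ∧
        orderOf (QuotientGroup.mk w :
          Feˣ ⧸ (powMonoidHom d : Feˣ →* Feˣ).range) = r := by
  classical
  have hq1 : 1 < q := hq ▸ Fintype.one_lt_card
  have hcard : Nat.card Feˣ = q ^ e - 1 := by
    rw [Nat.card_eq_fintype_card, Fintype.card_units, hFe]
  obtain ⟨w₀, hw₀⟩ := aux_order (G := Feˣ) d r (by rwa [hcard])
  set R := (powMonoidHom d : Feˣ →* Feˣ).range with hR
  let S : Finset Feˣ := Finset.univ.filter (fun w => (QuotientGroup.mk w : Feˣ ⧸ R) = QuotientGroup.mk w₀)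
  let B : Finset Feˣ := insert 1 ((Finset.Icc 1 (e / 2)).biUnion
    (fun k => Finset.univ.filter (fun w : Feˣ => (w : Fe) ^ q ^ k = w)))
  have hSR : Nat.card R ≤ S.card := by
    rw [Nat.card_eq_fintype_card, ← Finset.card_univ]
    refine Finset.card_le_card_of_injOn (fun x : R => w₀ * (x : Feˣ)) ?_ ?_
    · intro x _
      simp only [S, Finset.coe_filter, Finset.mem_univ, true_and, Set.mem_ofPred_eq]
      exact QuotientGroup.mk_mul_of_mem w₀ x.2
    · intro a _ b _ h
      exact Subtype.ext (mul_left_cancel h)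
  have hidx : R.index ≤ d := by
    rw [hR, IsCyclic.index_powMonoidHom_range]
    exact Nat.gcd_le_right _ (by omega)
  have hmul : Nat.card R * R.index = q ^ e - 1 := by rw [← hcard]; exact R.card_mul_index
  have hmul' : Nat.card R * R.index + 1 = q ^ e := by omega
  have hN : 4 * d < Nat.card R := by
    by_contra! h
    nlinarith [Nat.mul_le_mul h hidx]
  have hN2 : 4 * (q ^ e - 1) < Nat.card R ^ 2 := by
    rw [← hmul]
    nlinarith
  have hB : B.card < S.card := by
    refine lt_of_lt_of_le ?_ hSR
    rcases Nat.lt_or_ge e 2 with h | h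
    · have : e / 2 = 0 := by omega
      have hB1 : B.card = 1 := by simp [B, this]
      omega
    · have hB1 : B.card ≤ ∑ k ∈ Finset.Icc 1 (e / 2), q ^ k := by
        have : B = ((Finset.Icc 1 (e / 2)).biUnion
          (fun k => Finset.univ.filter (fun w : Feˣ => (w : Fe) ^ q ^ k = w))) := by
          apply Finset.insert_eq_of_mem
          simp only [Finset.mem_biUnion]
          exact ⟨1, by simp; omega, by simp⟩
        rw [this]
        refine Finset.card_biUnion_le.trans (Finset.sum_le_sum fun k hk => ?_)
        apply aux_roots
        rw [Finset.mem_Icc] at hk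
        exact hq1.trans_le (Nat.le_self_pow (by omega) q)
      have hs := aux_sum q (e / 2) hq1
      have hle : (q ^ (e / 2)) ^ 2 ≤ q ^ e := by
        rw [← pow_mul]
        exact Nat.pow_le_pow_right (by omega) (by omega)
      by_contra! hcon
      have h2 : Nat.card R + 2 ≤ 2 * q ^ (e / 2) := by omega
      have h3 : 4 * q ^ e < Nat.card R ^ 2 + 4 := by omega
      nlinarith
  obtain ⟨w, hwS, hwB⟩ := Finset.exists_mem_notMem_of_card_lt_card hB
  have hw : (QuotientGroup.mk w : Feˣ ⧸ R) = QuotientGroup.mk w₀ := by simpa [S] using hwS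
  have hw1 : (1 : Fe) - w ≠ 0 := by
    intro h
    apply hwB
    have : w = 1 := Units.ext (sub_eq_zero.mp h).symm
    simp [B, this]
  have h1γ : 1 + (w : Fe) / (1 - w) = 1 / (1 - w) := by field_simp; ring
  have h1γ0 : 1 + (w : Fe) / (1 - w) ≠ 0 := by rw [h1γ]; exact one_div_ne_zero hw1
  have hrel : (w : Fe) * (1 + (w : Fe) / (1 - w)) = (w : Fe) / (1 - w) := by
    rw [h1γ]; ring
  refine ⟨(w : Fe) / (1 - w), div_ne_zero w.ne_zero hw1, ?_, ?_, w, hrel, by rw [hw, hw₀]⟩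
  · intro h
    apply h1γ0
    rw [h]; ring
  · by_contra hγ
    obtain ⟨k, hk, hk'⟩ := aux_gen q e hq hFe _ _ h1γ0 hrel hγ
    apply hwB
    apply Finset.mem_insert_of_mem
    simp only [Finset.mem_biUnion]
    exact ⟨k, hk, by simpa using hk'⟩
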